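/- There does not exist a continuous function g : [0,1] → [0,1] with g(0) = 0 and g(1) = 1 for which there is a pairwise disjoint collection 𝒥 of nondegenerate closed subintervals of [1/4, 3/4] such that g⁻¹({1/2}) ⊆ ⋃𝒥 and, for every interval [c, d] ∈ 𝒥, either both g(c) < 1/2 and g(d) < 1/2, or both g(c) > 1/2 and g(d) > 1/2. -/

import Mathlib

open Set

/-- Lemma 5.8: there is no continuous `g : [0,1] → [0,1]` with `g(0) = 0`, `g(1) = 1`,
whose level set `g⁻¹(1/2)` is covered by a pairwise disjoint collection of
nondegenerate closed subintervals of `[1/4, 3/4]` on each of which both endpoint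
values lie strictly on the same side of `1/2`. -/
theorem statement14 :
    ¬ ∃ g : ℝ → ℝ, ContinuousOn g (Set.Icc (0 : ℝ) 1) ∧
      Set.MapsTo g (Set.Icc (0 : ℝ) 1) (Set.Icc (0 : ℝ) 1) ∧
      g 0 = 0 ∧ g 1 = 1 ∧
      ∃ 𝒥 : Set (ℝ × ℝ),
        (∀ J ∈ 𝒥, 1 / 4 ≤ J.1 ∧ J.1 < J.2 ∧ J.2 ≤ 3 / 4) ∧
        (∀ J ∈ 𝒥, ∀ J' ∈ 𝒥, J ≠ J' →
          Set.Icc J.1 J.2 ∩ Set.Icc J'.1 J'.2 = ∅) ∧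
        ({t | t ∈ Set.Icc (0 : ℝ) 1 ∧ g t = 1 / 2} ⊆ ⋃ J ∈ 𝒥, Set.Icc J.1 J.2) ∧
        (∀ J ∈ 𝒥, (g J.1 < 1 / 2 ∧ g J.2 < 1 / 2) ∨ (1 / 2 < g J.1 ∧ 1 / 2 < g J.2)) := by
  rintro ⟨g, hg, -, h0, h1, 𝒥, hJ, hdisj, hcov, hside⟩
  have hunique : ∀ J ∈ 𝒥, ∀ J' ∈ 𝒥, ∀ x ∈ Icc J.1 J.2, x ∈ Icc J'.1 J'.2 → J = J' := by
    intro J hJm J' hJm' x hx hx'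
    by_contra hne
    have hmem : x ∈ Icc J.1 J.2 ∩ Icc J'.1 J'.2 := ⟨hx, hx'⟩
    rw [hdisj J hJm J' hJm' hne] at hmem
    exact hmem
  have hleft : ∀ J ∈ 𝒥, ∀ J' ∈ 𝒥, J.1 ∉ Ioo J'.1 J'.2 := by
    intro J hJm J' hJm' hx
    have heq := hunique J hJm J' hJm' J.1 ⟨le_rfl, (hJ J hJm).2.1.le⟩ ⟨hx.1.le, hx.2.le⟩
    rw [heq] at hx
    exact lt_irrefl _ hx.1
  have hright : ∀ J ∈ 𝒥, ∀ J' ∈ 𝒥, J.2 ∉ Ioo J'.1 J'.2 := by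
    intro J hJm J' hJm' hx
    have heq := hunique J hJm J' hJm' J.2 ⟨(hJ J hJm).2.1.le, le_rfl⟩ ⟨hx.1.le, hx.2.le⟩
    rw [heq] at hx
    exact lt_irrefl _ hx.2
  -- The supremum of the points below level `1 / 2` lying inside no interval belongs to this set,
  -- yet larger members exist.
  let S : Set ℝ := {t | t ∈ Icc (0 : ℝ) 1 ∧ g t < 1 / 2 ∧ ∀ J ∈ 𝒥, t ∉ Ioo J.1 J.2}
  have hS0 : (0 : ℝ) ∈ S := by
    refine ⟨by simp, by rw [h0]; norm_num, fun J hJm hx => ?_⟩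
    linarith [(hJ J hJm).1, hx.1]
  have hbdd : BddAbove S := ⟨1, fun t ht => ht.1.2⟩
  obtain ⟨s, hs⟩ : ∃ s, IsLUB S s := ⟨_, isLUB_csSup ⟨0, hS0⟩ hbdd⟩
  have hs01 : s ∈ Icc (0 : ℝ) 1 := ⟨hs.1 hS0, hs.2 fun t ht => ht.1.2⟩
  have hsint : ∀ J ∈ 𝒥, s ∉ Ioo J.1 J.2 := by
    intro J hJm hx
    obtain ⟨t, ht, hct, hts⟩ := hs.exists_between hx.1
    exact ht.2.2 J hJm ⟨hct, hts.trans_lt hx.2⟩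
  have hsle : g s ≤ 1 / 2 := by
    have hcl : s ∈ closure S := hs.mem_closure ⟨0, hS0⟩
    have hcont : ContinuousWithinAt g S s := (hg s hs01).mono fun t ht => ht.1
    exact closure_minimal (fun y hy => by
      obtain ⟨t, ht, rfl⟩ := hy
      exact ht.2.1.le) isClosed_Iic (hcont.mem_closure_image hcl)
  have hslt : g s < 1 / 2 := by
    refine lt_of_le_of_ne hsle fun heq => ?_
    obtain ⟨J, hJm, hx⟩ := mem_iUnion₂.1 (hcov ⟨hs01, heq⟩)
    rcases hx.1.eq_or_lt with h | h
    · rw [← h] at heq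
      rcases hside J hJm with h' | h' <;> linarith [h'.1]
    rcases hx.2.eq_or_lt with h' | h'
    · rw [h'] at heq
      rcases hside J hJm with h' | h' <;> linarith [h'.2]
    · exact hsint J hJm ⟨h, h'⟩
  have hs1 : s < 1 := by
    refine lt_of_le_of_ne hs01.2 fun h => ?_
    rw [h, h1] at hslt
    norm_num at hslt
  obtain ⟨δ, hδ, hδg⟩ : ∃ δ > 0, ∀ t ∈ Icc (0 : ℝ) 1, dist t s < δ → g t < 1 / 2 := by
    obtain ⟨δ, hδ, h⟩ := Metric.continuousOn_iff.1 hg s hs01 (1 / 2 - g s) (by linarith)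
    refine ⟨δ, hδ, fun t ht htd => ?_⟩
    have := h t ht htd
    rw [Real.dist_eq] at this
    linarith [le_abs_self (g t - g s)]
  obtain ⟨t, hst, ht⟩ := exists_between (lt_min hs1 (lt_add_of_pos_right s hδ))
  have hbelow : ∀ u, s ≤ u → u ≤ t → u ∈ Icc (0 : ℝ) 1 ∧ g u < 1 / 2 := by
    intro u hsu hut
    have hu : u ∈ Icc (0 : ℝ) 1 := ⟨hs01.1.trans hsu, by linarith [ht.trans_le (min_le_left _ _)]⟩
    refine ⟨hu, hδg u hu ?_⟩
    rw [Real.dist_eq, abs_of_nonneg (by linarith)]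
    linarith [ht.trans_le (min_le_right _ _)]
  have htS : t ∉ S := fun h => absurd (hs.1 h) (not_le.2 hst)
  obtain ⟨J, hJm, htJ⟩ : ∃ J ∈ 𝒥, t ∈ Ioo J.1 J.2 := by
    by_contra! h
    exact htS ⟨(hbelow t hst.le le_rfl).1, (hbelow t hst.le le_rfl).2, h⟩
  rcases lt_trichotomy s J.1 with h | h | h
  · have hb := hbelow J.1 h.le htJ.1.le
    exact absurd (hs.1 ⟨hb.1, hb.2, hleft J hJm⟩) (not_le.2 h)
  · have hd : g J.2 < 1 / 2 := by
      rcases hside J hJm with h' | h'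
      · exact h'.2
      · rw [h] at hslt
        linarith [h'.1]
    have hd01 : J.2 ∈ Icc (0 : ℝ) 1 := ⟨by linarith [hs01.1, htJ.2], by linarith [(hJ J hJm).2.2]⟩
    exact absurd (hs.1 ⟨hd01, hd, hright J hJm⟩) (not_le.2 (hst.trans htJ.2))
  · exact hsint J hJm ⟨h, hst.trans htJ.2⟩
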